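/- Let J be a finite nonempty index set and L ≥ 1. For each j ∈ J, let a_{j,1}, …, a_{j,L} and b_{j,1}, …, b_{j,L} be strictly positive reals, and define w_{j,k} = a_{j,k} / Σ_{ℓ=1}^L a_{j,ℓ}. If Σ_{j ∈ J} Σ_{k=1}^L w_{j,k} · log(b_{j,k}) ≥ Σ_{j ∈ J} Σ_{k=1}^L w_{j,k} · log(a_{j,k}), then Σ_{j ∈ J} log( Σ_{k=1}^L b_{j,k} ) ≥ Σ_{j ∈ J} log( Σ_{k=1}^L a_{j,k} ). -/

import Mathlib

/-- Gibbs' inequality for unnormalized positive weights. -/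
lemma sum_div_mul_log_sub_log_le {ι : Type*} [Fintype ι] [Nonempty ι] {a b : ι → ℝ}
    (ha : ∀ k, 0 < a k) (hb : ∀ k, 0 < b k) :
    ∑ k, (a k / ∑ l, a l) * (Real.log (b k) - Real.log (a k))
      ≤ Real.log (∑ k, b k) - Real.log (∑ k, a k) := by
  have hA : 0 < ∑ k, a k := Finset.sum_pos (fun k _ => ha k) Finset.univ_nonempty
  have hB : 0 < ∑ k, b k := Finset.sum_pos (fun k _ => hb k) Finset.univ_nonempty
  set A := ∑ k, a k with hAdef
  set B := ∑ k, b k with hBdef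
  have key : ∀ k, (a k / A) * (Real.log (b k) - Real.log (a k))
      ≤ (a k / A) * (Real.log B - Real.log A) + (b k / B - a k / A) := by
    intro k
    have hak := ha k
    have hbk := hb k
    have hlog := Real.log_le_sub_one_of_pos (x := b k * A / (a k * B)) (by positivity)
    rw [Real.log_div (by positivity) (by positivity), Real.log_mul hbk.ne' hA.ne',
      Real.log_mul hak.ne' hB.ne'] at hlog
    have hmul := mul_le_mul_of_nonneg_left hlog (div_pos hak hA).le
    have hcancel : a k / A * (b k * A / (a k * B) - 1) = b k / B - a k / A := by
      field_simp
    linarith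
  calc ∑ k, (a k / A) * (Real.log (b k) - Real.log (a k))
      ≤ ∑ k, ((a k / A) * (Real.log B - Real.log A) + (b k / B - a k / A)) :=
        Finset.sum_le_sum fun k _ => key k
    _ = Real.log B - Real.log A := by
        rw [Finset.sum_add_distrib, Finset.sum_sub_distrib, ← Finset.sum_mul,
          ← Finset.sum_div, ← Finset.sum_div, ← hAdef, ← hBdef, div_self hA.ne',
          div_self hB.ne']
        ring

/-- Ascent property of the generalized EM algorithm: improving the expected complete
log-likelihood does not decrease the observed-data log-likelihood. -/
theorem em_ascent
    {J : Type*} [Fintype J] [Nonempty J] (L : ℕ) (hL : 1 ≤ L)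
    (a b : J → Fin L → ℝ)
    (ha : ∀ j k, 0 < a j k) (hb : ∀ j k, 0 < b j k)
    (h : ∑ j, ∑ k, (a j k / ∑ ℓ, a j ℓ) * Real.log (a j k)
        ≤ ∑ j, ∑ k, (a j k / ∑ ℓ, a j ℓ) * Real.log (b j k)) :
    ∑ j, Real.log (∑ k, a j k) ≤ ∑ j, Real.log (∑ k, b j k) := by
  have : Nonempty (Fin L) := ⟨⟨0, hL⟩⟩
  have hsum := Finset.sum_le_sum fun j (_ : j ∈ Finset.univ) =>
    sum_div_mul_log_sub_log_le (ha j) (hb j)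
  simp only [mul_sub, Finset.sum_sub_distrib] at hsum
  linarith
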